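/- Let V be a nonempty finite set with |V| = N, and let ω assign a real weight to every unordered pair of distinct elements of V (i.e., to every edge of the complete graph on V), with all assigned weights pairwise distinct. For each real number t, let G_t denote the thresholded graph on V in which two distinct vertices u and v are adjacent if and only if ω({u,v}) > t. Then for every natural number K with 1 ≤ K ≤ N there exists a real threshold t such that G_t has exactly K connected components. -/

import Mathlib

/-- The thresholded graph `G_t` on vertex set `V` for an edge-weight function `ω`:
distinct vertices `u`, `v` are adjacent iff `ω {u,v} > t`. -/
def thresholdGraph {V : Type*} (ω : Sym2 V → ℝ) (t : ℝ) : SimpleGraph V where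
  Adj u v := u ≠ v ∧ t < ω s(u, v)
  symm := by
    constructor
    intro u v h
    exact ⟨h.1.symm, by rw [Sym2.eq_swap]; exact h.2⟩
  loopless := by
    constructor
    intro v h
    exact h.1 rfl

lemma reach_aux {V : Type*} {G H : SimpleGraph V} (a b : V)
    (h : ∀ u v, H.Adj u v → G.Adj u v ∨ s(u, v) = s(a, b)) {u v : V} (p : H.Walk u v) :
    G.Reachable u v ∨ ((G.Reachable u a ∨ G.Reachable u b) ∧
      (G.Reachable v a ∨ G.Reachable v b)) := by
  induction p with
  | nil => exact Or.inl (SimpleGraph.Reachable.refl _)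
  | cons hadj p ih =>
    rename_i x y z
    rcases h _ _ hadj with h1 | h1
    · have h2 := h1.reachable
      rcases ih with ih | ⟨ih1, ih2⟩
      · exact Or.inl (h2.trans ih)
      · exact Or.inr ⟨ih1.imp h2.trans h2.trans, ih2⟩
    · right
      rw [Sym2.eq_iff] at h1
      rcases h1 with ⟨rfl, rfl⟩ | ⟨rfl, rfl⟩
      · refine ⟨Or.inl (SimpleGraph.Reachable.refl _), ?_⟩
        rcases ih with ih | ih
        · exact Or.inr ih.symm
        · exact ih.2
      · refine ⟨Or.inr (SimpleGraph.Reachable.refl _), ?_⟩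
        rcases ih with ih | ih
        · exact Or.inl ih.symm
        · exact ih.2

lemma card_aux {V : Type*} [Finite V] {G H : SimpleGraph V} (hle : G ≤ H) (a b : V)
    (h : ∀ u v, H.Adj u v → G.Adj u v ∨ s(u, v) = s(a, b)) :
    Nat.card G.ConnectedComponent ≤ Nat.card H.ConnectedComponent + 1 := by
  classical
  rw [← Finite.card_option]
  let f : G.ConnectedComponent → Option H.ConnectedComponent := fun x =>
    if x = G.connectedComponentMk a then none
    else some (x.map (SimpleGraph.Hom.ofLE hle))
  apply Nat.card_le_card_of_injective f
  intro x y
  induction x using SimpleGraph.ConnectedComponent.ind with | _ u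
  induction y using SimpleGraph.ConnectedComponent.ind with | _ v
  intro hxy
  simp only [f] at hxy
  split_ifs at hxy with h1 h2 h2
  · rw [h1, h2]
  · rw [Option.some_inj] at hxy
    simp only [SimpleGraph.ConnectedComponent.map_mk, SimpleGraph.ConnectedComponent.eq] at hxy h1 h2 ⊢
    obtain ⟨p⟩ := hxy
    rcases reach_aux a b h p with h3 | ⟨h3, h4⟩
    · exact h3
    · exact (h3.resolve_left h1).trans (h4.resolve_left h2).symm

/-- For a nonempty finite vertex set `V` with `|V| = N` and pairwise-distinct real weights on
the edges of the complete graph on `V`, for every `K` with `1 ≤ K ≤ N` there is a threshold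
`t` such that the thresholded graph `G_t` has exactly `K` connected components. -/
theorem exists_threshold_with_K_components
    {V : Type*} [Fintype V] [Nonempty V] {N : ℕ} (hN : Fintype.card V = N)
    (ω : Sym2 V → ℝ)
    (hdistinct : ∀ e e' : Sym2 V, ¬ e.IsDiag → ¬ e'.IsDiag → ω e = ω e' → e = e')
    (K : ℕ) (hK1 : 1 ≤ K) (hKN : K ≤ N) :
    ∃ t : ℝ, Nat.card (thresholdGraph ω t).ConnectedComponent = K := by
  classical
  let c : ℝ → ℕ := fun t => Nat.card (thresholdGraph ω t).ConnectedComponent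
  let A : Finset ℝ := Finset.univ.image ω
  have hA : ∀ e, ω e ∈ A := fun e => Finset.mem_image_of_mem _ (Finset.mem_univ _)
  have hAne : A.Nonempty := ⟨_, hA s(Classical.arbitrary V, Classical.arbitrary V)⟩
  have hmax : K ≤ c (A.max' hAne) := by
    have hbot : thresholdGraph ω (A.max' hAne) = ⊥ := by
      ext u v
      simp only [thresholdGraph, SimpleGraph.bot_adj, iff_false]
      rintro ⟨_, h⟩
      exact absurd (A.le_max' _ (hA s(u, v))) (not_le.mpr h)
    have hinj : Function.Injective
        (thresholdGraph ω (A.max' hAne)).connectedComponentMk := by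
      rw [hbot]
      intro u v h
      simpa using h
    have := Nat.card_le_card_of_injective _ hinj
    rw [Nat.card_eq_fintype_card, hN] at this
    exact hKN.trans this
  obtain ⟨t₀, ht₀, hmin⟩ := (A.filter (fun t => K ≤ c t)).exists_min_image id
    ⟨_, Finset.mem_filter.mpr ⟨A.max'_mem hAne, hmax⟩⟩
  obtain ⟨ht₀A, ht₀K⟩ := Finset.mem_filter.mp ht₀
  -- a threshold just below `t₀`
  obtain ⟨t₁, hlt, hgap, hcK⟩ : ∃ t₁ < t₀, (∀ e, t₁ < ω e → t₀ ≤ ω e) ∧ c t₁ ≤ K ∧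
      (c t₁ < K ∨ c t₁ = K) := by
    by_cases hB : (A.filter (fun t => t < t₀)).Nonempty
    · have hm := Finset.max'_mem _ hB
      obtain ⟨hmA, hml⟩ := Finset.mem_filter.mp hm
      have hlt : c ((A.filter (fun t => t < t₀)).max' hB) < K := by
        by_contra hc
        have := hmin _ (Finset.mem_filter.mpr ⟨hmA, not_lt.mp hc⟩)
        exact absurd hml (not_lt.mpr this)
      refine ⟨_, hml, ?_, hlt.le, Or.inl hlt⟩
      intro e he
      by_contra hc
      have hmem : ω e ∈ A.filter (fun t => t < t₀) :=
        Finset.mem_filter.mpr ⟨hA e, not_le.mp hc⟩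
      exact absurd (Finset.le_max' _ _ hmem) (not_le.mpr he)
    · have hall : ∀ e, t₀ ≤ ω e := fun e => by
        by_contra hc
        exact hB ⟨_, Finset.mem_filter.mpr ⟨hA e, not_le.mp hc⟩⟩
      have h1 : c (t₀ - 1) ≤ 1 := by
        have : Subsingleton (thresholdGraph ω (t₀ - 1)).ConnectedComponent := by
          constructor
          intro x y
          induction x using SimpleGraph.ConnectedComponent.ind with | _ u
          induction y using SimpleGraph.ConnectedComponent.ind with | _ v
          by_cases huv : u = v
          · rw [huv]
          · apply SimpleGraph.ConnectedComponent.sound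
            apply SimpleGraph.Adj.reachable
            exact ⟨huv, by linarith [hall s(u, v)]⟩
        exact Finite.card_le_one_iff_subsingleton.mpr this
      refine ⟨t₀ - 1, by linarith, fun e _ => hall e, by omega, by omega⟩
  rcases hcK.2 with hc | hc
  swap
  · exact ⟨t₁, hc⟩
  refine ⟨t₀, le_antisymm ?_ ht₀K⟩
  have hle : thresholdGraph ω t₀ ≤ thresholdGraph ω t₁ := fun u v h => ⟨h.1, hlt.trans h.2⟩
  obtain ⟨a, b, hab⟩ : ∃ a b : V, ∀ u v, (thresholdGraph ω t₁).Adj u v →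
      (thresholdGraph ω t₀).Adj u v ∨ s(u, v) = s(a, b) := by
    by_cases hE : ∃ a b : V, a ≠ b ∧ ω s(a, b) = t₀
    · obtain ⟨a, b, hne, he⟩ := hE
      refine ⟨a, b, fun u v h => ?_⟩
      rcases (hgap _ h.2).lt_or_eq with h1 | h1
      · exact Or.inl ⟨h.1, h1⟩
      · exact Or.inr (hdistinct _ _ (by simpa using h.1) (by simpa using hne) (by rw [he, h1]))
    · refine ⟨Classical.arbitrary V, Classical.arbitrary V, fun u v h => Or.inl ⟨h.1, ?_⟩⟩
      exact lt_of_le_of_ne (hgap _ h.2) fun h1 => hE ⟨u, v, h.1, h1.symm⟩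
  have := card_aux hle a b hab
  change c t₀ ≤ c t₁ + 1 at this
  change c t₀ ≤ K
  omega
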